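/- The Lazy Capacity Provisioning (LCP) algorithm is 3-competitive for the discrete data-center optimization problem: for every instance, C(X^LCP) ≤ 3·C(X*), where X* is any optimal schedule. -/

import Mathlib

open Finset

noncomputable section

/-- Feasibility of a (truncated) schedule for time horizon `τ` with `m` servers:
`x 0 = 0` and `x t ∈ {0, …, m}` for `t ∈ {1, …, τ}`. -/
def Feas (τ m : ℕ) (x : ℕ → ℕ) : Prop :=
  x 0 = 0 ∧ ∀ t ∈ Finset.Icc 1 τ, x t ≤ m

/-- `C^L_τ(X) = ∑_{t=1}^τ f_t(x_t) + β ∑_{t=1}^τ (x_t − x_{t−1})⁺`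
(switching cost charged for powering up). -/
def CL (τ : ℕ) (β : ℝ) (f : ℕ → ℕ → ℝ) (x : ℕ → ℕ) : ℝ :=
  ∑ t ∈ Finset.Icc 1 τ, f t (x t)
    + β * ∑ t ∈ Finset.Icc 1 τ, max ((x t : ℝ) - (x (t - 1) : ℝ)) 0

/-- `C^U_τ(X) = ∑_{t=1}^τ f_t(x_t) + β ∑_{t=1}^τ (x_{t−1} − x_t)⁺`
(switching cost charged for powering down). -/
def CU (τ : ℕ) (β : ℝ) (f : ℕ → ℕ → ℝ) (x : ℕ → ℕ) : ℝ :=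
  ∑ t ∈ Finset.Icc 1 τ, f t (x t)
    + β * ∑ t ∈ Finset.Icc 1 τ, max ((x (t - 1) : ℝ) - (x t : ℝ)) 0

/-- The set of final states `x τ` of minimizers of `C^L_τ`. -/
def FinalL (τ m : ℕ) (β : ℝ) (f : ℕ → ℕ → ℝ) : Set ℕ :=
  {n | ∃ x : ℕ → ℕ, Feas τ m x ∧ x τ = n ∧
    ∀ y : ℕ → ℕ, Feas τ m y → CL τ β f x ≤ CL τ β f y}

/-- The set of final states `x τ` of minimizers of `C^U_τ`. -/
def FinalU (τ m : ℕ) (β : ℝ) (f : ℕ → ℕ → ℝ) : Set ℕ :=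
  {n | ∃ x : ℕ → ℕ, Feas τ m x ∧ x τ = n ∧
    ∀ y : ℕ → ℕ, Feas τ m y → CU τ β f x ≤ CU τ β f y}

/-- Convexity of a sequence on `{0, …, m}`: its increments are nondecreasing. -/
def ConvexUpTo (m : ℕ) (g : ℕ → ℝ) : Prop :=
  ∀ a b : ℕ, a ≤ b → b + 1 ≤ m → g (a + 1) - g a ≤ g (b + 1) - g b

/-- Infimal convolution on `{0, …, m}` of `g` with the power-up cost `z ↦ β z⁺`. -/
def infConv (m : ℕ) (β : ℝ) (g : ℕ → ℝ) (x : ℕ) : ℝ :=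
  (Finset.range (m + 1)).inf' ⟨0, by simp⟩ fun y => g y + β * max ((x : ℝ) - y) 0

/-- The work function: the cheapest way to serve the first `τ` steps and then be in state `x`,
the final move to `x` included. -/
def workFun (m : ℕ) (β : ℝ) (f : ℕ → ℕ → ℝ) : ℕ → ℕ → ℝ
  | 0, x => β * x
  | τ + 1, x => infConv m β (fun y => f (τ + 1) y + workFun m β f τ y) x

lemma infConv_le {m : ℕ} (β : ℝ) (g : ℕ → ℝ) (x : ℕ) {y : ℕ} (hy : y ≤ m) :
    infConv m β g x ≤ g y + β * max ((x : ℝ) - y) 0 :=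
  Finset.inf'_le (f := fun y : ℕ => g y + β * max ((x : ℝ) - y) 0)
    (Finset.mem_range.2 (Nat.lt_succ_of_le hy))

lemma exists_infConv_eq (m : ℕ) (β : ℝ) (g : ℕ → ℝ) (x : ℕ) :
    ∃ y ≤ m, infConv m β g x = g y + β * max ((x : ℝ) - y) 0 := by
  obtain ⟨y, hy, h⟩ := Finset.exists_mem_eq_inf' (s := Finset.range (m + 1)) ⟨0, by simp⟩
    (fun y : ℕ => g y + β * max ((x : ℝ) - y) 0)
  exact ⟨y, Nat.le_of_lt_succ (Finset.mem_range.1 hy), h⟩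

lemma le_infConv {m : ℕ} {β : ℝ} {g : ℕ → ℝ} {x : ℕ} {c : ℝ}
    (h : ∀ y ≤ m, c ≤ g y + β * max ((x : ℝ) - y) 0) : c ≤ infConv m β g x := by
  obtain ⟨y, hy, e⟩ := exists_infConv_eq m β g x
  exact e ▸ h y hy

/-- The forward increment of a convex sequence is a subgradient. -/
lemma ConvexUpTo.subgradient {m : ℕ} {g : ℕ → ℝ} (hg : ConvexUpTo m g) {x y : ℕ}
    (hx : x + 1 ≤ m) (hy : y ≤ m) :
    g x + ((y : ℝ) - x) * (g (x + 1) - g x) ≤ g y := by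
  rcases le_total x y with h | h
  · induction y, h using Nat.le_induction with
    | base => simp
    | succ n hn ih =>
      have h1 := ih (by omega)
      have h2 := hg x n hn hy
      push_cast
      linarith
  · obtain ⟨k, rfl⟩ := Nat.exists_eq_add_of_le h
    clear h
    induction k generalizing y with
    | zero => simp
    | succ k ih =>
      have e : y + (k + 1) = y + 1 + k := by ring
      rw [e] at hx ⊢
      have h1 := ih (y := y + 1) (by omega) (by omega)
      have h2 := hg y (y + 1 + k) (by omega) hx
      push_cast at h1 ⊢
      linarith

lemma ConvexUpTo.add {m : ℕ} {g h : ℕ → ℝ} (hg : ConvexUpTo m g) (hh : ConvexUpTo m h) :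
    ConvexUpTo m fun x => g x + h x := by
  intro a b hab hb
  have := hg a b hab hb
  have := hh a b hab hb
  simp only
  linarith

lemma infConv_mono {m : ℕ} {β : ℝ} (hβ : 0 ≤ β) (g : ℕ → ℝ) (x : ℕ) :
    infConv m β g x ≤ infConv m β g (x + 1) := by
  refine le_infConv fun y hy => (infConv_le β g x hy).trans ?_
  gcongr
  omega

lemma infConv_succ_le {m : ℕ} {β : ℝ} (hβ : 0 ≤ β) (g : ℕ → ℝ) (x : ℕ) :
    infConv m β g (x + 1) ≤ infConv m β g x + β := by
  obtain ⟨y, hy, e⟩ := exists_infConv_eq m β g x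
  have h := infConv_le β g (x + 1) hy
  have h2 : max (((x + 1 : ℕ) : ℝ) - y) 0 ≤ max ((x : ℝ) - y) 0 + 1 := by
    push_cast
    refine max_le ?_ ?_
    · linarith [le_max_left ((x : ℝ) - y) 0]
    · linarith [le_max_right ((x : ℝ) - y) 0]
  have h3 := mul_le_mul_of_nonneg_left h2 hβ
  linarith

/-- Infimal convolution with `z ↦ β z⁺` clamps the increments of a convex sequence to `[0, β]`. -/
lemma infConv_increment {m : ℕ} {β : ℝ} (hβ : 0 ≤ β) {g : ℕ → ℝ} (hg : ConvexUpTo m g)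
    {x : ℕ} (hx : x + 1 ≤ m) :
    infConv m β g (x + 1) - infConv m β g x = max 0 (min β (g (x + 1) - g x)) := by
  have hmono := infConv_mono (m := m) hβ g x
  have hlip := infConv_succ_le (m := m) hβ g x
  have hx1 := infConv_le β g (x + 1) hx
  have hx0 := infConv_le β g x (show x ≤ m by omega)
  simp only [sub_self, max_self, mul_zero, add_zero] at hx1 hx0
  have key : ∀ y ≤ m, g x + ((y : ℝ) - x) * (g (x + 1) - g x) ≤ g y :=
    fun y hy => hg.subgradient hx hy
  set s := g (x + 1) - g x with hs
  rcases le_total s 0 with h0 | h0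
  · rw [min_eq_right (h0.trans hβ), max_eq_left h0]
    refine le_antisymm (sub_nonpos.2 (le_infConv fun y hy => ?_)) (sub_nonneg.2 hmono)
    have hk := key y hy
    rcases le_or_gt y x with h | h
    · have hc : (y : ℝ) ≤ x := by exact_mod_cast h
      have : 0 ≤ β * max ((x : ℝ) - y) 0 := mul_nonneg hβ (le_max_right _ _)
      nlinarith
    · have h' := infConv_le β g (x + 1) hy
      have hc : ((x + 1 : ℕ) : ℝ) ≤ y := by exact_mod_cast h
      rw [max_eq_right (by linarith)] at h'
      have : 0 ≤ β * max ((x : ℝ) - y) 0 := mul_nonneg hβ (le_max_right _ _)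
      linarith
  rcases le_total β s with h1 | h1
  · rw [min_eq_left h1, max_eq_right hβ]
    refine le_antisymm (by linarith) (le_sub_iff_add_le.2 (le_infConv fun y hy => ?_))
    have hk := key y hy
    rcases le_or_gt y x with h | h
    · have h' := infConv_le β g x hy
      have hc : (y : ℝ) ≤ x := by exact_mod_cast h
      rw [max_eq_left (by linarith)] at h'
      rw [max_eq_left (by push_cast; linarith)]
      push_cast
      linarith
    · have hc : ((x + 1 : ℕ) : ℝ) ≤ y := by exact_mod_cast h
      rw [max_eq_right (by linarith)]
      push_cast at hc
      nlinarith
  · rw [min_eq_right h1, max_eq_right h0]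
    have e0 : infConv m β g x = g x := by
      refine le_antisymm hx0 (le_infConv fun y hy => ?_)
      have hk := key y hy
      rcases le_or_gt y x with h | h
      · have hc : (y : ℝ) ≤ x := by exact_mod_cast h
        rw [max_eq_left (by linarith)]
        nlinarith
      · have hc : (x : ℝ) ≤ y := by exact_mod_cast h.le
        rw [max_eq_right (by linarith)]
        nlinarith
    have e1 : infConv m β g (x + 1) = g (x + 1) := by
      refine le_antisymm hx1 (le_infConv fun y hy => ?_)
      have hk := key y hy
      rcases le_or_gt y x with h | h
      · have hc : (y : ℝ) ≤ x := by exact_mod_cast h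
        rw [max_eq_left (by push_cast; linarith)]
        push_cast
        nlinarith
      · have hc : ((x + 1 : ℕ) : ℝ) ≤ y := by exact_mod_cast h
        rw [max_eq_right (by linarith)]
        push_cast at hc
        nlinarith
    rw [e0, e1]

lemma ConvexUpTo.infConv {m : ℕ} {β : ℝ} (hβ : 0 ≤ β) {g : ℕ → ℝ} (hg : ConvexUpTo m g) :
    ConvexUpTo m (infConv m β g) := by
  intro a b hab hb
  rw [infConv_increment hβ hg (by omega), infConv_increment hβ hg hb]
  exact max_le_max le_rfl (min_le_min le_rfl (hg a b hab hb))

lemma workFun_increment_mem {m : ℕ} {β : ℝ} (hβ : 0 ≤ β) (f : ℕ → ℕ → ℝ) (τ x : ℕ) :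
    workFun m β f τ x ≤ workFun m β f τ (x + 1) ∧
      workFun m β f τ (x + 1) ≤ workFun m β f τ x + β := by
  cases τ with
  | zero =>
    simp only [workFun]
    push_cast
    constructor <;> linarith
  | succ τ => exact ⟨infConv_mono hβ _ x, infConv_succ_le hβ _ x⟩

lemma workFun_le_add {m : ℕ} {β : ℝ} (hβ : 0 ≤ β) (f : ℕ → ℕ → ℝ) (τ x y : ℕ) :
    workFun m β f τ x ≤ workFun m β f τ y + β * max ((x : ℝ) - y) 0 := by
  rcases le_total x y with h | h
  · have h1 := monotone_nat_of_le_succ (fun n => (workFun_increment_mem (m := m) hβ f τ n).1) h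
    have h2 : 0 ≤ β * max ((x : ℝ) - y) 0 := mul_nonneg hβ (le_max_right _ _)
    linarith
  · induction x, h using Nat.le_induction with
    | base => simp
    | succ n hn ih =>
      have h1 := (workFun_increment_mem (m := m) hβ f τ n).2
      have hc : (y : ℝ) ≤ n := by exact_mod_cast hn
      rw [max_eq_left (by linarith)] at ih
      rw [max_eq_left (by push_cast; linarith)]
      push_cast
      linarith

lemma workFun_convexUpTo {T m : ℕ} {β : ℝ} (hβ : 0 ≤ β) {f : ℕ → ℕ → ℝ}
    (hconv : ∀ t ∈ Finset.Icc 1 T, ConvexUpTo m (f t)) {τ : ℕ} (hτ : τ ≤ T) :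
    ConvexUpTo m (workFun m β f τ) := by
  induction τ with
  | zero =>
    intro a b _ _
    simp only [workFun]
    push_cast
    linarith
  | succ τ ih =>
    exact ConvexUpTo.infConv hβ
      ((hconv (τ + 1) (by simp; omega)).add (ih (by omega)))

lemma workFun_le_succ {m : ℕ} {β : ℝ} (hβ : 0 ≤ β) {f : ℕ → ℕ → ℝ} {τ : ℕ}
    (hf : ∀ j ≤ m, 0 ≤ f (τ + 1) j) (x : ℕ) :
    workFun m β f τ x ≤ workFun m β f (τ + 1) x :=
  le_infConv fun y hy => by
    have h1 := workFun_le_add (m := m) hβ f τ x y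
    have h2 := hf y hy
    linarith

/-- One step raises the work function at any state by at most the sum of the raises at the two
extreme states. -/
lemma workFun_step_le {m : ℕ} {β : ℝ} (hβ : 0 ≤ β) {f : ℕ → ℕ → ℝ} {τ : ℕ}
    (hw : ConvexUpTo m (workFun m β f τ)) (hfc : ConvexUpTo m (f (τ + 1)))
    (hf : ∀ j ≤ m, 0 ≤ f (τ + 1) j) {x : ℕ} (hx : x ≤ m) :
    workFun m β f (τ + 1) x - workFun m β f τ x ≤
      (workFun m β f (τ + 1) 0 - workFun m β f τ 0) +
        (workFun m β f (τ + 1) m - workFun m β f τ m) := by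
  have hinc : ∀ y, y + 1 ≤ m → workFun m β f (τ + 1) (y + 1) - workFun m β f (τ + 1) y =
      max 0 (min β (f (τ + 1) (y + 1) + workFun m β f τ (y + 1) -
        (f (τ + 1) y + workFun m β f τ y))) :=
    fun y hy => infConv_increment hβ (hfc.add hw) hy
  have hpos0 := workFun_le_succ hβ hf 0
  have hposm := workFun_le_succ hβ hf m
  rcases Nat.lt_or_ge x m with hlt | hge
  · rcases le_total 0 (f (τ + 1) (x + 1) - f (τ + 1) x) with h0 | h0
    · have : workFun m β f (τ + 1) x - workFun m β f τ x ≤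
          workFun m β f (τ + 1) m - workFun m β f τ m := by
        have aux : ∀ n, x ≤ n → n ≤ m → workFun m β f (τ + 1) x - workFun m β f τ x ≤
            workFun m β f (τ + 1) n - workFun m β f τ n := by
          intro n hn
          induction n, hn using Nat.le_induction with
          | base => intro _; exact le_rfl
          | succ n hn ih =>
            intro hnm
            have h1 := ih (by omega)
            have h2 := hinc n hnm
            have h3 := hfc x n hn hnm
            have h4 := workFun_increment_mem (m := m) hβ f τ n
            have h5 : workFun m β f τ (n + 1) - workFun m β f τ n ≤
                min β (f (τ + 1) (n + 1) + workFun m β f τ (n + 1) -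
                  (f (τ + 1) n + workFun m β f τ n)) :=
              le_min (by linarith) (by linarith)
            have h6 := h5.trans (le_max_right 0 _)
            linarith
        exact aux m hx le_rfl
      linarith
    · have aux : ∀ n ≤ x, workFun m β f (τ + 1) n - workFun m β f τ n ≤
          workFun m β f (τ + 1) 0 - workFun m β f τ 0 := by
        intro n
        induction n with
        | zero => intro _; exact le_rfl
        | succ n ih =>
          intro hn
          have h1 := ih (by omega)
          have h2 := hinc n (by omega)
          have h3 := hfc n x (by omega) hlt
          have h4 := workFun_increment_mem (m := m) hβ f τ n
          have h5 : max 0 (min β (f (τ + 1) (n + 1) + workFun m β f τ (n + 1) -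
              (f (τ + 1) n + workFun m β f τ n))) ≤
              workFun m β f τ (n + 1) - workFun m β f τ n :=
            max_le (by linarith) ((min_le_right _ _).trans (by linarith))
          linarith
      have := aux x le_rfl
      linarith
  · obtain rfl : x = m := le_antisymm hx hge
    linarith

lemma CL_succ (τ : ℕ) (β : ℝ) (f : ℕ → ℕ → ℝ) (x : ℕ → ℕ) :
    CL (τ + 1) β f x =
      CL τ β f x + (f (τ + 1) (x (τ + 1)) + β * max ((x (τ + 1) : ℝ) - x τ) 0) := by
  simp only [CL, Finset.sum_Icc_succ_top (Nat.le_add_left 1 τ), Nat.add_sub_cancel]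
  ring

lemma CL_congr {τ : ℕ} (β : ℝ) (f : ℕ → ℕ → ℝ) {x y : ℕ → ℕ} (h : ∀ t ≤ τ, x t = y t) :
    CL τ β f x = CL τ β f y := by
  induction τ with
  | zero => simp [CL]
  | succ τ ih =>
    rw [CL_succ, CL_succ, ih fun t ht => h t (by omega), h _ le_rfl, h τ (by omega)]

lemma CU_eq {τ : ℕ} (β : ℝ) (f : ℕ → ℕ → ℝ) {x : ℕ → ℕ} (h : x 0 = 0) :
    CU τ β f x = CL τ β f x - β * x τ := by
  induction τ with
  | zero => simp [CL, CU, h]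
  | succ τ ih =>
    have e : CU (τ + 1) β f x =
        CU τ β f x + (f (τ + 1) (x (τ + 1)) + β * max ((x τ : ℝ) - x (τ + 1)) 0) := by
      simp only [CU, Finset.sum_Icc_succ_top (Nat.le_add_left 1 τ), Nat.add_sub_cancel]
      ring
    have e2 : max ((x τ : ℝ) - x (τ + 1)) 0 =
        max ((x (τ + 1) : ℝ) - x τ) 0 - (x (τ + 1) - x τ) := by
      rcases le_total (x τ : ℝ) (x (τ + 1)) with h | h
      · rw [max_eq_right (by linarith), max_eq_left (by linarith)]; ring
      · rw [max_eq_left (by linarith), max_eq_right (by linarith)]; ring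
    rw [e, ih, CL_succ, e2]
    ring

lemma workFun_le_CL {m : ℕ} (β : ℝ) (f : ℕ → ℕ → ℝ) {τ : ℕ} {x : ℕ → ℕ}
    (hx : Feas τ m x) (n : ℕ) :
    workFun m β f τ n ≤ CL τ β f x + β * max ((n : ℝ) - x τ) 0 := by
  induction τ generalizing n with
  | zero => simp [workFun, CL, hx.1]
  | succ τ ih =>
    have h1 := ih ⟨hx.1, fun t ht => hx.2 t (by simp at ht ⊢; omega)⟩ (x (τ + 1))
    have h2 := infConv_le β (fun y => f (τ + 1) y + workFun m β f τ y) n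
      (hx.2 (τ + 1) (by simp))
    rw [CL_succ]
    simp only [workFun] at h2 ⊢
    linarith

lemma exists_extension {m τ : ℕ} (β : ℝ) (f : ℕ → ℕ → ℝ) {x : ℕ → ℕ} (hx : Feas τ m x)
    {y : ℕ} (hy : y ≤ m) :
    ∃ z, Feas (τ + 1) m z ∧ z (τ + 1) = y ∧
      CL (τ + 1) β f z = f (τ + 1) y + (CL τ β f x + β * max ((y : ℝ) - x τ) 0) := by
  refine ⟨Function.update x (τ + 1) y, ⟨?_, fun t ht => ?_⟩, by simp, ?_⟩
  · rw [Function.update_of_ne (by omega), hx.1]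
  · rcases eq_or_ne t (τ + 1) with rfl | hne
    · simpa using hy
    · rw [Function.update_of_ne hne]
      exact hx.2 t (by simp at ht ⊢; omega)
  · rw [CL_succ, CL_congr β f (y := x) fun t ht => Function.update_of_ne (by omega) _ _]
    rw [Function.update_self, Function.update_of_ne (by omega)]
    ring

lemma exists_CL_eq_workFun (m : ℕ) (β : ℝ) (f : ℕ → ℕ → ℝ) (τ n : ℕ) :
    ∃ x, Feas τ m x ∧ CL τ β f x + β * max ((n : ℝ) - x τ) 0 = workFun m β f τ n := by
  induction τ generalizing n with
  | zero => exact ⟨fun _ => 0, ⟨rfl, by simp⟩, by simp [workFun, CL]⟩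
  | succ τ ih =>
    obtain ⟨y, hy, e⟩ := exists_infConv_eq m β (fun y => f (τ + 1) y + workFun m β f τ y) n
    obtain ⟨x, hx, hxe⟩ := ih y
    obtain ⟨z, hz, hzy, hze⟩ := exists_extension β f hx hy
    refine ⟨z, hz, ?_⟩
    simp only [workFun]
    rw [e, hze, hxe, hzy]

lemma step_cost_le_CL {m : ℕ} (β : ℝ) (f : ℕ → ℕ → ℝ) {τ : ℕ} {x : ℕ → ℕ}
    (hx : Feas (τ + 1) m x) :
    f (τ + 1) (x (τ + 1)) + workFun m β f τ (x (τ + 1)) ≤ CL (τ + 1) β f x := by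
  have h := workFun_le_CL β f (τ := τ) (x := x)
    ⟨hx.1, fun t ht => hx.2 t (by simp at ht ⊢; omega)⟩ (x (τ + 1))
  rw [CL_succ]
  linarith

lemma exists_CL_eq_step_cost {m : ℕ} (β : ℝ) (f : ℕ → ℕ → ℝ) (τ : ℕ) {n : ℕ} (hn : n ≤ m) :
    ∃ x, Feas (τ + 1) m x ∧ x (τ + 1) = n ∧
      CL (τ + 1) β f x = f (τ + 1) n + workFun m β f τ n := by
  obtain ⟨x, hx, hxe⟩ := exists_CL_eq_workFun m β f τ n
  obtain ⟨z, hz, hzn, hze⟩ := exists_extension β f hx hn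
  exact ⟨z, hz, hzn, by rw [hze, hxe]⟩

lemma FinalL_spec {m : ℕ} {β : ℝ} {f : ℕ → ℕ → ℝ} {τ n : ℕ}
    (h : n ∈ FinalL (τ + 1) m β f) :
    n ≤ m ∧ ∀ k ≤ m, f (τ + 1) n + workFun m β f τ n ≤ f (τ + 1) k + workFun m β f τ k := by
  obtain ⟨x, hx, rfl, hmin⟩ := h
  refine ⟨hx.2 _ (by simp), fun k hk => ?_⟩
  obtain ⟨z, hz, -, hze⟩ := exists_CL_eq_step_cost β f τ hk
  exact (step_cost_le_CL β f hx).trans ((hmin z hz).trans hze.le)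

lemma FinalU_spec {m : ℕ} {β : ℝ} {f : ℕ → ℕ → ℝ} {τ n : ℕ}
    (h : n ∈ FinalU (τ + 1) m β f) :
    n ≤ m ∧ ∀ k ≤ m, f (τ + 1) n + workFun m β f τ n - β * n ≤
      f (τ + 1) k + workFun m β f τ k - β * k := by
  obtain ⟨x, hx, rfl, hmin⟩ := h
  refine ⟨hx.2 _ (by simp), fun k hk => ?_⟩
  obtain ⟨z, hz, hzk, hze⟩ := exists_CL_eq_step_cost β f τ hk
  have h1 := hmin z hz
  rw [CU_eq β f hx.1, CU_eq β f hz.1, hze, hzk] at h1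
  linarith [step_cost_le_CL β f hx]

/-- Between a minimizer of `g` and a minimizer of `g - β ·`, a convex sequence agrees with its
infimal convolution. -/
lemma ConvexUpTo.le_infConv_of_between {m : ℕ} {β : ℝ} {g : ℕ → ℝ}
    (hg : ConvexUpTo m g) {l u x : ℕ} (hl : ∀ k ≤ m, g l ≤ g k) (hum : u ≤ m)
    (hu : ∀ k ≤ m, g u - β * u ≤ g k - β * k) (hlx : l ≤ x) (hxu : x ≤ u) :
    g x ≤ _root_.infConv m β g x := by
  refine le_infConv fun y hy => ?_
  rcases le_or_gt y x with h | h
  · have hyx : (y : ℝ) ≤ x := by exact_mod_cast h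
    rw [max_eq_left (by linarith)]
    rcases hxu.eq_or_lt with rfl | hlt
    · linarith [hu y hy]
    · have hc : (x : ℝ) < u := by exact_mod_cast hlt
      have h1 := hg.subgradient (x := x) (by omega) hum
      have h2 := hu x (by omega)
      have h3 := hg.subgradient (x := x) (by omega) hy
      have h4 : g (x + 1) - g x ≤ β := by
        by_contra! hcon
        nlinarith
      nlinarith
  · have hxy : (x : ℝ) < y := by exact_mod_cast h
    rw [max_eq_right (by linarith)]
    rcases hlx.eq_or_lt with rfl | hlt
    · linarith [hl y hy]
    · have hc : (l : ℝ) < x := by exact_mod_cast hlt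
      have h1 := hg.subgradient (x := x) (y := l) (by omega) (by omega)
      have h2 := hl x (by omega)
      have h3 := hg.subgradient (x := x) (by omega) hy
      have h4 : 0 ≤ g (x + 1) - g x := by
        by_contra! hcon
        nlinarith
      nlinarith

/-- The Lazy Capacity Provisioning algorithm is 3-competitive:
`C(X^LCP) ≤ 3·C(X*)` for every optimal schedule `X*` (the total cost is
`C = C^L_T`). -/
theorem stmt13 (T m : ℕ) (β : ℝ) (hβ : 0 < β)
    (f : ℕ → ℕ → ℝ)
    (hconv : ∀ t ∈ Finset.Icc 1 T, ∀ a b : ℕ, a ≤ b → b + 1 ≤ m →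
      f t (a + 1) - f t a ≤ f t (b + 1) - f t b)
    (hnonneg : ∀ t ∈ Finset.Icc 1 T, ∀ j : ℕ, j ≤ m → 0 ≤ f t j)
    (xL xU : ℕ → ℕ)
    (hxL : ∀ τ ∈ Finset.Icc 1 T, IsLeast (FinalL τ m β f) (xL τ))
    (hxU : ∀ τ ∈ Finset.Icc 1 T, IsGreatest (FinalU τ m β f) (xU τ))
    (xlcp : ℕ → ℕ) (hlcp0 : xlcp 0 = 0)
    (hlcp : ∀ τ ∈ Finset.Icc 1 T, xlcp τ = max (xL τ) (min (xU τ) (xlcp (τ - 1))))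
    (xstar : ℕ → ℕ) (hfeas : Feas T m xstar)
    (hopt : ∀ y : ℕ → ℕ, Feas T m y → CL T β f xstar ≤ CL T β f y) :
    CL T β f xlcp ≤ 3 * CL T β f xstar := by
  have hβ' := hβ.le
  have inv : ∀ τ ≤ T, xlcp τ ≤ m ∧
      ∑ t ∈ Finset.Icc 1 τ, f t (xlcp t) ≤
        workFun m β f τ 0 + (workFun m β f τ m - β * m) ∧
      β * ∑ t ∈ Finset.Icc 1 τ, max ((xlcp t : ℝ) - (xlcp (t - 1) : ℝ)) 0 ≤
        workFun m β f τ 0 + (workFun m β f τ m - β * m) -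
          (workFun m β f τ (xlcp τ) - β * xlcp τ) := by
    intro τ
    induction τ with
    | zero => intro _; simp [workFun, hlcp0]
    | succ τ ih =>
      intro hτ
      obtain ⟨hm, hop, hsw⟩ := ih (by omega)
      have hmem : τ + 1 ∈ Finset.Icc 1 T := by simp; omega
      have hfc : ConvexUpTo m (f (τ + 1)) := hconv _ hmem
      have hw : ConvexUpTo m (workFun m β f τ) := workFun_convexUpTo hβ' hconv (by omega)
      have hstep : ∀ x ≤ m, _ := fun x hx => workFun_step_le hβ' hw hfc (hnonneg _ hmem) hx
      obtain ⟨hLm, hL⟩ := FinalL_spec (hxL _ hmem).1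
      obtain ⟨hUm, hU⟩ := FinalU_spec (hxU _ hmem).1
      have hdef := hlcp _ hmem
      rw [Nat.add_sub_cancel] at hdef
      have hLU : xL (τ + 1) ≤ xU (τ + 1) := by
        by_contra! hcon
        have hc : (xU (τ + 1) : ℝ) < xL (τ + 1) := by exact_mod_cast hcon
        have h1 := hL _ hUm
        have h2 := hU _ hLm
        nlinarith
      have hlo : xL (τ + 1) ≤ xlcp (τ + 1) := hdef ▸ le_max_left _ _
      have hhi : xlcp (τ + 1) ≤ xU (τ + 1) := hdef ▸ max_le hLU (min_le_left _ _)
      have hm' : xlcp (τ + 1) ≤ m := hhi.trans hUm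
      have hagree : f (τ + 1) (xlcp (τ + 1)) + workFun m β f τ (xlcp (τ + 1)) ≤
          workFun m β f (τ + 1) (xlcp (τ + 1)) :=
        (hfc.add hw).le_infConv_of_between hL hUm hU hlo hhi
      have hle : workFun m β f (τ + 1) (xlcp (τ + 1)) ≤
          f (τ + 1) (xlcp (τ + 1)) + workFun m β f τ (xlcp (τ + 1)) := by
        have h := infConv_le β (fun y => f (τ + 1) y + workFun m β f τ y) (xlcp (τ + 1)) hm'
        simpa [workFun] using h
      have hmove : workFun m β f (τ + 1) (xlcp (τ + 1)) - β * xlcp (τ + 1) +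
          β * max ((xlcp (τ + 1) : ℝ) - xlcp τ) 0 ≤
            workFun m β f (τ + 1) (xlcp τ) - β * xlcp τ := by
        rcases lt_trichotomy (xlcp τ) (xlcp (τ + 1)) with h | h | h
        · have e : xlcp (τ + 1) = xL (τ + 1) := by omega
          have hc : (xlcp τ : ℝ) < xlcp (τ + 1) := by exact_mod_cast h
          have hmin : f (τ + 1) (xL (τ + 1)) + workFun m β f τ (xL (τ + 1)) ≤
              workFun m β f (τ + 1) (xlcp τ) :=
            le_infConv fun y hy => (hL y hy).trans
              (le_add_of_nonneg_right (mul_nonneg hβ' (le_max_right _ _)))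
          rw [max_eq_left (by linarith)]
          rw [← e] at hmin
          linarith
        · rw [h]; simp
        · have e : xlcp (τ + 1) = xU (τ + 1) := by omega
          have hc : (xlcp (τ + 1) : ℝ) < xlcp τ := by exact_mod_cast h
          have hmin : f (τ + 1) (xU (τ + 1)) + workFun m β f τ (xU (τ + 1)) -
              β * xU (τ + 1) + β * xlcp τ ≤ workFun m β f (τ + 1) (xlcp τ) :=
            le_infConv fun y hy => by
              have h1 := hU y hy
              have h2 := mul_le_mul_of_nonneg_left (le_max_left ((xlcp τ : ℝ) - y) 0) hβ'
              linarith
          rw [max_eq_right (by linarith)]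
          rw [← e] at hmin
          linarith
      refine ⟨hm', ?_, ?_⟩
      · rw [Finset.sum_Icc_succ_top (Nat.le_add_left 1 τ)]
        have := hstep _ hm'
        linarith
      · rw [Finset.sum_Icc_succ_top (Nat.le_add_left 1 τ), Nat.add_sub_cancel, mul_add]
        have := hstep _ hm
        linarith
  obtain ⟨hm, hop, hsw⟩ := inv T le_rfl
  have hA := workFun_le_CL β f hfeas 0
  have hB := workFun_le_CL β f hfeas m
  have hstar : (xstar T : ℝ) ≤ m := by
    rcases Nat.eq_zero_or_pos T with rfl | hT
    · simp [hfeas.1]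
    · exact_mod_cast hfeas.2 T (by simp; omega)
  have hM := workFun_le_add (m := m) hβ' f T m (xlcp T)
  have hmr : (xlcp T : ℝ) ≤ m := by exact_mod_cast hm
  rw [max_eq_left (by linarith)] at hB hM
  rw [max_eq_right (by simp)] at hA
  have hx0 : 0 ≤ β * (xstar T : ℝ) := by positivity
  rw [show CL T β f xlcp = _ from rfl, CL]
  linarith
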